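/- Let X be a nonempty set and let Φ be a mapping with domain X². Then the following four conditions are equivalent: (i) there is a totally ordered set Q (with smallest element) such that Φ is combinatorially similar to a Q-pseudoultrametric; (ii) there is a poset Q (with smallest element) such that Φ is combinatorially similar to a Q-pseudoultrametric; (iii) Φ is symmetric, the transitive closure u_Φᵗ of u_Φ is antisymmetric, Φ is a₀-coherent for some a₀ ∈ Φ(X²), and for every triple ⟨x₁,x₂,x₃⟩ of points of X there is a permutation ⟨x_{i₁},x_{i₂},x_{i₃}⟩ of it such that Φ(x_{i₁},x_{i₂}) = Φ(x_{i₂},x_{i₃}); (iv) there is b₀ ∈ Φ(X²) such that Φ(x,x) = b₀ for every x ∈ X, the binary relation ≼_Φ := u_Φᵗ ∪ Δ_{Φ(X²)} is a partial order on Φ(X²), b₀ is the smallest element of (Φ(X²), ≼_Φ), and Φ is a ≼_Φ-pseudoultrametric on X. -/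

import Mathlib

namespace CombSimPaper

/-- The range `Φ(X²)` of a mapping `Φ` with domain `X²`. -/
def rng {X A : Type*} (Φ : X → X → A) : Set A := {a | ∃ x y, Φ x y = a}

/-- `Φ` is strongly consistent with the binary relation `R` on `X`. -/
def StronglyConsistent {X A : Type*} (Φ : X → X → A) (R : X → X → Prop) : Prop :=
  ∀ x₁ x₂ x₃ x₄, R x₁ x₂ → R x₃ x₄ → Φ x₁ x₃ = Φ x₂ x₄

/-- The fiber `Φ⁻¹(a)`, viewed as a binary relation on `X`. -/
def fiber {X A : Type*} (Φ : X → X → A) (a : A) : X → X → Prop :=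
  fun x y => Φ x y = a

/-- `Φ` is `a₀`-coherent: the fiber `Φ⁻¹(a₀)` is an equivalence relation and `Φ` is
strongly consistent with it. -/
def Coherent {X A : Type*} (Φ : X → X → A) (a₀ : A) : Prop :=
  Equivalence (fiber Φ a₀) ∧ StronglyConsistent Φ (fiber Φ a₀)

/-- `g : Y → X` is a combinatorial similarity for the mappings `Ψ` (with domain `Y²`)
and `Φ` (with domain `X²`). -/
def CombSimWith {X Y A B : Type*} (Φ : X → X → A) (Ψ : Y → Y → B) (g : Y → X) : Prop :=
  Function.Bijective g ∧ ∃ f : A → B, Set.BijOn f (rng Φ) (rng Ψ) ∧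
    ∀ x y : Y, Ψ x y = f (Φ (g x) (g y))

/-- `Φ` is combinatorially similar to `Ψ`. -/
def CombSim {X Y A B : Type*} (Φ : X → X → A) (Ψ : Y → Y → B) : Prop :=
  ∃ g : Y → X, CombSimWith Φ Ψ g

/-- Some permutation `⟨x_{i₁}, x_{i₂}, x_{i₃}⟩` of the triple `⟨x₁, x₂, x₃⟩`
satisfies the ternary predicate `P`. -/
def PermTriple {X : Type*} (P : X → X → X → Prop) (x₁ x₂ x₃ : X) : Prop :=
  ∃ σ : Equiv.Perm (Fin 3),
    P (![x₁, x₂, x₃] (σ 0)) (![x₁, x₂, x₃] (σ 1)) (![x₁, x₂, x₃] (σ 2))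

/-- `d : X² → Q` is a `≼`-pseudoultrametric (for the order `le` with smallest element `q₀`). -/
def QPseudoUltra {X Q : Type*} (le : Q → Q → Prop) (q₀ : Q) (d : X → X → Q) : Prop :=
  (∀ x y, d x y = d y x) ∧ (∀ x, d x x = q₀) ∧
  ∀ x₁ x₂ x₃, PermTriple (fun a b c => le (d a c) (d a b) ∧ d a b = d b c) x₁ x₂ x₃

/-- `d : X² → Q` is a `≼`-ultrametric. -/
def QUltra {X Q : Type*} (le : Q → Q → Prop) (q₀ : Q) (d : X → X → Q) : Prop :=
  QPseudoUltra le q₀ d ∧ ∀ x y, d x y = q₀ ↔ x = y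

/-- The binary relation `u_Φ` on the range of `Φ`. -/
def uRel {X A : Type*} (Φ : X → X → A) : A → A → Prop :=
  fun y₁ y₂ => ∃ x₁ x₂ x₃, y₁ = Φ x₁ x₃ ∧ y₂ = Φ x₁ x₂ ∧ Φ x₁ x₂ = Φ x₂ x₃

/-- The binary relation `≼_Φ := u_Φᵗ ∪ Δ_{Φ(X²)}`. -/
def lePhi {X A : Type*} (Φ : X → X → A) : A → A → Prop :=
  fun a b => Relation.TransGen (uRel Φ) a b ∨ (a = b ∧ a ∈ rng Φ)

/-- `r` is a partial order on the subset `S`. -/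
def IsPartialOrderOn {A : Type*} (S : Set A) (r : A → A → Prop) : Prop :=
  (∀ a ∈ S, r a a) ∧
  (∀ a b c, a ∈ S → b ∈ S → c ∈ S → r a b → r b c → r a c) ∧
  (∀ a b, a ∈ S → b ∈ S → r a b → r b a → a = b)

/-- `r` is a linear (total) order on the subset `S`. -/
def IsLinearOrderOn {A : Type*} (S : Set A) (r : A → A → Prop) : Prop :=
  IsPartialOrderOn S r ∧ ∀ a b, a ∈ S → b ∈ S → (r a b ∨ r b a)

/-- A (real-valued, nonnegative) pseudometric. -/
def IsPseudoMetric {X : Type*} (d : X → X → ℝ) : Prop :=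
  (∀ x y, 0 ≤ d x y) ∧ (∀ x y, d x y = d y x) ∧ (∀ x, d x x = 0) ∧
  ∀ x y z, d x y ≤ d x z + d z y

/-- A (real-valued) metric. -/
def IsMetric {X : Type*} (d : X → X → ℝ) : Prop :=
  IsPseudoMetric d ∧ ∀ x y, d x y = 0 ↔ x = y

/-- A (real-valued, nonnegative) pseudoultrametric. -/
def IsPseudoUltrametric {X : Type*} (d : X → X → ℝ) : Prop :=
  (∀ x y, 0 ≤ d x y) ∧ (∀ x y, d x y = d y x) ∧ (∀ x, d x x = 0) ∧
  ∀ x y z, d x y ≤ max (d x z) (d z y)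

/-- A (real-valued) ultrametric. -/
def IsUltrametric {X : Type*} (d : X → X → ℝ) : Prop :=
  IsPseudoUltrametric d ∧ ∀ x y, d x y = 0 ↔ x = y

/-- `d` is a `le`-pseudoultrametric, where `le` is a partial order on `Q` having a smallest
element. -/
def IsPseudoUltraFor {X Q : Type*} (d : X → X → Q) (le : Q → Q → Prop) : Prop :=
  IsPartialOrder Q le ∧ ∃ q₀, (∀ q, le q₀ q) ∧ QPseudoUltra le q₀ d

/-- `g : X₁ → X₂` is a weak similarity for the `Q₁`-pseudoultrametric `d₁` and the
`Q₂`-pseudoultrametric `d₂`: `g` is a bijection and there is an order isomorphism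
`f` of the subposet `d₂(X₂²)` of `Q₂` onto the subposet `d₁(X₁²)` of `Q₁` with
`d₁(x, y) = f (d₂ (g x) (g y))`. -/
def WeakSim {X₁ X₂ Q₁ Q₂ : Type*} (le₁ : Q₁ → Q₁ → Prop) (le₂ : Q₂ → Q₂ → Prop)
    (d₁ : X₁ → X₁ → Q₁) (d₂ : X₂ → X₂ → Q₂) (g : X₁ → X₂) : Prop :=
  Function.Bijective g ∧ ∃ f : Q₂ → Q₁,
    Set.BijOn f (rng d₂) (rng d₁) ∧
    (∀ a ∈ rng d₂, ∀ b ∈ rng d₂, (le₂ a b ↔ le₁ (f a) (f b))) ∧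
    ∀ x y, d₁ x y = f (d₂ (g x) (g y))

/-- The subset `S`, ordered by `r`, is order-isomorphic to a subposet of `(ℝ⁺, ≤)`. -/
def EmbedsInRPlus {A : Type*} (S : Set A) (r : A → A → Prop) : Prop :=
  ∃ e : A → ℝ, (∀ a ∈ S, 0 ≤ e a) ∧ Set.InjOn e S ∧
    ∀ a ∈ S, ∀ b ∈ S, (r a b ↔ e a ≤ e b)

universe u v

theorem PermTriple.mono {X : Type*} {P R : X → X → X → Prop} (h : ∀ a b c, P a b c → R a b c)
    {x y z : X} : PermTriple P x y z → PermTriple R x y z :=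
  fun ⟨σ, hσ⟩ => ⟨σ, h _ _ _ hσ⟩

theorem PermTriple.cases {X : Type*} {P : X → X → X → Prop} {x y z : X}
    (h : PermTriple P x y z) :
    P x y z ∨ P x z y ∨ P y x z ∨ P y z x ∨ P z x y ∨ P z y x := by
  obtain ⟨σ, hσ⟩ := h
  have h01 : σ 0 ≠ σ 1 := σ.injective.ne (by decide)
  have h02 : σ 0 ≠ σ 2 := σ.injective.ne (by decide)
  have h12 : σ 1 ≠ σ 2 := σ.injective.ne (by decide)
  generalize σ 0 = i at *
  generalize σ 1 = j at *
  generalize σ 2 = k at *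
  fin_cases i <;> fin_cases j <;> fin_cases k <;> simp_all

theorem mem_rng {X A : Type*} (Φ : X → X → A) (x y : X) : Φ x y ∈ rng Φ := ⟨x, y, rfl⟩

namespace QPseudoUltra

variable {X Q : Type*} {le : Q → Q → Prop} {q₀ : Q} {d : X → X → Q}

theorem isosceles (hd : QPseudoUltra le q₀ d) (x y z : X) :
    (le (d x z) (d x y) ∧ d x y = d y z) ∨ (le (d y z) (d x y) ∧ d x y = d x z) ∨
      (le (d x y) (d x z) ∧ d x z = d y z) := by
  have hyx := hd.1 y x
  have hzx := hd.1 z x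
  have hzy := hd.1 z y
  rcases (hd.2.2 x y z).cases with h | h | h | h | h | h <;> grind

theorem le_of_eq_legs [Std.Refl le] (hd : QPseudoUltra le q₀ d) {x y z : X}
    (h : d x y = d y z) : le (d x z) (d x y) := by
  rcases hd.isosceles x y z with h' | h' | h'
  · exact h'.1
  · exact h'.2 ▸ refl_of le _
  · rw [h'.2, h]; exact refl_of le _

theorem eq_of_eq_bot [IsPartialOrder Q le] (hmin : ∀ q, le q₀ q) (hd : QPseudoUltra le q₀ d)
    {x y : X} (h : d x y = q₀) (z : X) : d x z = d y z := by
  have hbot : ∀ q, le q q₀ → q = q₀ := fun q hq => antisymm_of le hq (hmin q)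
  rcases hd.isosceles x y z with ⟨h₁, h₂⟩ | ⟨h₁, h₂⟩ | ⟨h₁, h₂⟩
  · rw [h] at h₁ h₂
    rw [hbot _ h₁, h₂]
  · rw [h] at h₁ h₂
    rw [hbot _ h₁, h₂]
  · exact h₂

end QPseudoUltra

section CombSim

variable {X Y A Q : Type*} {Φ : X → X → A} {le : Q → Q → Prop} {q₀ : Q} {d : Y → Y → Q}

/-- A mapping combinatorially similar to a pseudoultrametric becomes a pseudoultrametric after
relabelling its values injectively. -/
theorem CombSim.exists_injOn (h : CombSim Φ d) (hd : QPseudoUltra le q₀ d) :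
    ∃ f : A → Q, Set.InjOn f (rng Φ) ∧ QPseudoUltra le q₀ (fun x y => f (Φ x y)) := by
  obtain ⟨g, hg, f, hf, hfd⟩ := h
  have key : ∀ x y, f (Φ x y) =
      d ((Equiv.ofBijective g hg).symm x) ((Equiv.ofBijective g hg).symm y) := fun x y => by
    rw [hfd, Equiv.ofBijective_apply_symm_apply g hg, Equiv.ofBijective_apply_symm_apply g hg]
  refine ⟨f, hf.injOn, fun x y => ?_, fun x => ?_, fun x y z => ?_⟩
  · simp only [key, hd.1]
  · simp only [key, hd.2.1]
  · obtain ⟨σ, hσ⟩ := hd.2.2 ((Equiv.ofBijective g hg).symm x)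
      ((Equiv.ofBijective g hg).symm y) ((Equiv.ofBijective g hg).symm z)
    have hv : ∀ i, (Equiv.ofBijective g hg).symm (![x, y, z] i) =
        ![(Equiv.ofBijective g hg).symm x, (Equiv.ofBijective g hg).symm y,
          (Equiv.ofBijective g hg).symm z] i := by
      intro i
      fin_cases i <;> rfl
    refine ⟨σ, ?_⟩
    simpa only [key, hv] using hσ

end CombSim

section Relabel

variable {X A Q : Type*} {Φ : X → X → A} {le : Q → Q → Prop} {q₀ : Q} {f : A → Q}

theorem transGen_uRel_mem_rng {a b : A} (h : Relation.TransGen (uRel Φ) a b) :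
    a ∈ rng Φ ∧ b ∈ rng Φ := by
  induction h with
  | single h =>
    obtain ⟨x, y, z, rfl, rfl, -⟩ := h
    exact ⟨mem_rng .., mem_rng ..⟩
  | tail _ h ih =>
    obtain ⟨x, y, z, -, rfl, -⟩ := h
    exact ⟨ih.1, mem_rng ..⟩

theorem le_of_transGen_uRel [IsPreorder Q le] (hd : QPseudoUltra le q₀ (fun x y => f (Φ x y)))
    {a b : A} (h : Relation.TransGen (uRel Φ) a b) : le (f a) (f b) := by
  have step : ∀ a b, uRel Φ a b → le (f a) (f b) := by
    rintro _ _ ⟨x, y, z, rfl, rfl, h⟩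
    exact hd.le_of_eq_legs (congrArg f h)
  induction h with
  | single h => exact step _ _ h
  | tail _ h ih => exact trans_of le ih (step _ _ h)

theorem antiSymmetric_transGen_uRel [IsPartialOrder Q le] (hf : Set.InjOn f (rng Φ))
    (hd : QPseudoUltra le q₀ (fun x y => f (Φ x y))) :
    AntiSymmetric (Relation.TransGen (uRel Φ)) := fun _ _ hab hba =>
  hf (transGen_uRel_mem_rng hab).1 (transGen_uRel_mem_rng hab).2
    (antisymm_of le (le_of_transGen_uRel hd hab) (le_of_transGen_uRel hd hba))

theorem coherent_of_injOn [IsPartialOrder Q le] (hmin : ∀ q, le q₀ q)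
    (hf : Set.InjOn f (rng Φ)) (hd : QPseudoUltra le q₀ (fun x y => f (Φ x y))) (x₀ : X) :
    Coherent Φ (Φ x₀ x₀) := by
  have hinj : ∀ {x y z w}, f (Φ x y) = f (Φ z w) → Φ x y = Φ z w :=
    fun h => hf (mem_rng ..) (mem_rng ..) h
  have hsymm : ∀ x y, Φ x y = Φ y x := fun x y => hinj (hd.1 x y)
  have hcongr : ∀ {x y}, Φ x y = Φ x₀ x₀ → ∀ z, Φ x z = Φ y z := fun {x y} h z =>
    hinj (hd.eq_of_eq_bot hmin ((congrArg f h).trans (hd.2.1 x₀)) z)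
  refine ⟨⟨fun x => hinj ((hd.2.1 x).trans (hd.2.1 x₀).symm), fun {x y} h => ?_,
    fun {x y z} hxy hyz => (hcongr hxy z).trans hyz⟩, fun x₁ x₂ x₃ x₄ h h' => ?_⟩
  · exact (hsymm y x).trans h
  · rw [hcongr h x₃, hsymm x₂ x₃, hcongr h' x₂, hsymm x₄ x₂]

end Relabel

section LePhi

variable {X A : Type*} {Φ : X → X → A}

theorem lePhi_of_uRel {a b : A} (h : uRel Φ a b) : lePhi Φ a b := Or.inl (.single h)

theorem isPartialOrderOn_lePhi (h : AntiSymmetric (Relation.TransGen (uRel Φ))) :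
    IsPartialOrderOn (rng Φ) (lePhi Φ) := by
  refine ⟨fun a ha => Or.inr ⟨rfl, ha⟩, ?_, ?_⟩
  · rintro a b c - - - (hab | ⟨rfl, -⟩) (hbc | ⟨rfl, hb⟩)
    · exact Or.inl (hab.trans hbc)
    · exact Or.inl hab
    · exact Or.inl hbc
    · exact Or.inr ⟨rfl, hb⟩
  · rintro a b - - (hab | ⟨rfl, -⟩) (hba | ⟨hba, -⟩)
    · exact h hab hba
    · exact hba.symm
    · rfl
    · rfl

theorem exists_linearOrder_combSim {b₀ : A} (hb₀ : b₀ ∈ rng Φ)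
    (hpo : IsPartialOrderOn (rng Φ) (lePhi Φ)) (hmin : ∀ b ∈ rng Φ, lePhi Φ b₀ b)
    (hΦ : QPseudoUltra (lePhi Φ) b₀ Φ) :
    ∃ (le : rng Φ → rng Φ → Prop) (q₀ : rng Φ) (d : X → X → rng Φ),
      IsLinearOrder (rng Φ) le ∧ (∀ q, le q₀ q) ∧ QPseudoUltra le q₀ d ∧ CombSim Φ d := by
  classical
  have : IsPartialOrder (rng Φ) (fun a b => lePhi Φ a b) :=
    { refl := fun a => hpo.1 a a.2
      trans := fun a b c => hpo.2.1 a b c a.2 b.2 c.2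
      antisymm := fun a b hab hba => Subtype.ext (hpo.2.2 a b a.2 b.2 hab hba) }
  obtain ⟨le, hlin, hle⟩ := extend_partialOrder (fun a b : rng Φ => lePhi Φ a b)
  refine ⟨le, ⟨b₀, hb₀⟩, fun x y => ⟨Φ x y, mem_rng Φ x y⟩, hlin, fun q => hle _ _ (hmin q q.2),
    ⟨fun x y => Subtype.ext (hΦ.1 x y), fun x => Subtype.ext (hΦ.2.1 x), fun x y z =>
      (hΦ.2.2 x y z).mono fun a b c h => ⟨hle _ _ h.1, Subtype.ext h.2⟩⟩,
    id, Function.bijective_id, fun a => if h : a ∈ rng Φ then ⟨a, h⟩ else ⟨b₀, hb₀⟩,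
    ⟨?_, ?_, ?_⟩, fun x y => by simp [mem_rng]⟩
  · rintro _ ⟨x, y, rfl⟩
    exact ⟨x, y, by simp [mem_rng]⟩
  · intro a ha b hb hab
    simpa [ha, hb] using hab
  · rintro _ ⟨x, y, rfl⟩
    exact ⟨Φ x y, mem_rng Φ x y, by simp [mem_rng]⟩

end LePhi

/-- Theorem 3.15: for a mapping `Φ` with domain `X²`, the following are equivalent:
(i) `Φ` is combinatorially similar to a `Q`-pseudoultrametric for some totally ordered `Q`
with smallest element; (ii) the same for some poset `Q` with smallest element; (iii) `Φ` is
symmetric, `u_Φᵗ` is antisymmetric, `Φ` is `a₀`-coherent for some `a₀` in its range, and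
every triple admits an isosceles permutation; (iv) `Φ(x,x) = b₀` is constant,
`≼_Φ := u_Φᵗ ∪ Δ_{Φ(X²)}` is a partial order on `Φ(X²)` with smallest element `b₀`, and `Φ`
is a `≼_Φ`-pseudoultrametric. -/
theorem statement7 {X : Type u} {A : Type v} [Nonempty X] (Φ : X → X → A) :
    List.TFAE [
      ∃ (Q : Type v) (leQ : Q → Q → Prop) (q₀ : Q), IsLinearOrder Q leQ ∧ (∀ q, leQ q₀ q) ∧
        ∃ (Y : Type u) (_ : Nonempty Y) (d : Y → Y → Q), QPseudoUltra leQ q₀ d ∧ CombSim Φ d,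
      ∃ (Q : Type v) (leQ : Q → Q → Prop) (q₀ : Q), IsPartialOrder Q leQ ∧ (∀ q, leQ q₀ q) ∧
        ∃ (Y : Type u) (_ : Nonempty Y) (d : Y → Y → Q), QPseudoUltra leQ q₀ d ∧ CombSim Φ d,
      (∀ x y, Φ x y = Φ y x) ∧
        AntiSymmetric (Relation.TransGen (uRel Φ)) ∧
        (∃ a₀ ∈ rng Φ, Coherent Φ a₀) ∧
        (∀ x₁ x₂ x₃ : X, PermTriple (fun a b c => Φ a b = Φ b c) x₁ x₂ x₃),
      ∃ b₀ ∈ rng Φ, (∀ x, Φ x x = b₀) ∧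
        IsPartialOrderOn (rng Φ) (lePhi Φ) ∧
        (∀ b ∈ rng Φ, lePhi Φ b₀ b) ∧
        QPseudoUltra (lePhi Φ) b₀ Φ ] := by
  tfae_have 1 → 2 := by
    rintro ⟨Q, le, q₀, hle, h⟩
    exact ⟨Q, le, q₀, hle.toIsPartialOrder, h⟩
  tfae_have 2 → 3 := by
    rintro ⟨Q, le, q₀, hle, hmin, Y, -, d, hd, hsim⟩
    obtain ⟨f, hf, hfd⟩ := hsim.exists_injOn hd
    obtain ⟨x₀⟩ := ‹Nonempty X›
    exact ⟨fun x y => hf (mem_rng ..) (mem_rng ..) (hfd.1 x y),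
      antiSymmetric_transGen_uRel hf hfd,
      ⟨Φ x₀ x₀, mem_rng .., coherent_of_injOn hmin hf hfd x₀⟩,
      fun x y z => (hfd.2.2 x y z).mono fun a b c h => hf (mem_rng ..) (mem_rng ..) h.2⟩
  tfae_have 3 → 4 := by
    rintro ⟨hsymm, hanti, ⟨a₀, ha₀, hequiv, -⟩, htri⟩
    refine ⟨a₀, ha₀, hequiv.refl, isPartialOrderOn_lePhi hanti, ?_, hsymm, hequiv.refl,
      fun x y z => (htri x y z).mono fun a b c h => ⟨lePhi_of_uRel ⟨a, b, c, rfl, rfl, h⟩, h⟩⟩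
    rintro _ ⟨x, y, rfl⟩
    exact lePhi_of_uRel ⟨x, y, x, (hequiv.refl x).symm, rfl, hsymm x y⟩
  tfae_have 4 → 1 := by
    rintro ⟨b₀, hb₀, -, hpo, hmin, hΦ⟩
    obtain ⟨le, q₀, d, hlin, hq₀, hd, hsim⟩ := exists_linearOrder_combSim hb₀ hpo hmin hΦ
    exact ⟨rng Φ, le, q₀, hlin, hq₀, X, inferInstance, d, hd, hsim⟩
  tfae_finish

end CombSimPaper
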